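/- Let (J, ·, α) be a finite-dimensional multiplicative Hom-Jordan superalgebra with α invertible. Then the even linear map ad⋆ : J → End(J*) defined by ad⋆(x)(f) = ad*(α(x))((α⁻²)*(f)) for homogeneous x ∈ J, f ∈ J* (where ad(x)(y) = x·y and ⟨ad*(x)(f), y⟩ = (-1)^{|x||f|} ⟨f, x·y⟩) makes (J*, ad⋆, (α⁻¹)*) a representation of (J, ·, α), called the coadjoint representation. -/

import Mathlib

open scoped TensorProduct

noncomputable section

/-- The sign `(-1)^e` attached to a parity `e : ZMod 2`. -/
def gsign (K : Type*) [Field K] (e : ZMod 2) : K := (-1 : K) ^ e.val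

variable {K : Type*} [Field K] [CharZero K]
variable {J V : Type*} [AddCommGroup J] [Module K J] [AddCommGroup V] [Module K V]

/-- An even bilinear map with respect to a `ZMod 2`-grading. -/
def EvenBilin (g : ZMod 2 → Submodule K J) (m : J →ₗ[K] J →ₗ[K] J) : Prop :=
  ∀ i j : ZMod 2, ∀ x ∈ g i, ∀ y ∈ g j, m x y ∈ g (i + j)

/-- An even linear map with respect to a `ZMod 2`-grading. -/
def EvenMap (g : ZMod 2 → Submodule K J) (α : J →ₗ[K] J) : Prop :=
  ∀ i : ZMod 2, ∀ x ∈ g i, α x ∈ g i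

/-- Super-commutativity `x·y = (-1)^{|x||y|} y·x` on homogeneous elements. -/
def SuperComm (g : ZMod 2 → Submodule K J) (m : J →ₗ[K] J →ₗ[K] J) : Prop :=
  ∀ i j : ZMod 2, ∀ x ∈ g i, ∀ y ∈ g j, m x y = gsign K (i * j) • m y x

/-- The Hom-associator `as_α(x,y,z) = (x·y)·α(z) − α(x)·(y·z)`. -/
def hAss (m : J →ₗ[K] J →ₗ[K] J) (α : J →ₗ[K] J) (x y z : J) : J :=
  m (m x y) (α z) - m (α x) (m y z)

/-- The Hom-Jordan super-identity: the cyclic sum over `(x,y,u)` of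
`(-1)^{|u|(|x|+|z|)} as_α(x·y, α(z), α(u))` vanishes. -/
def HomJordanId (g : ZMod 2 → Submodule K J) (m : J →ₗ[K] J →ₗ[K] J) (α : J →ₗ[K] J) : Prop :=
  ∀ px py pz pu : ZMod 2, ∀ x ∈ g px, ∀ y ∈ g py, ∀ z ∈ g pz, ∀ u ∈ g pu,
      gsign K (pu * (px + pz)) • hAss m α (m x y) (α z) (α u)
    + gsign K (px * (py + pz)) • hAss m α (m y u) (α z) (α x)
    + gsign K (py * (pu + pz)) • hAss m α (m u x) (α z) (α y) = 0

/-- Hom-Jordan superalgebra. -/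
def IsHomJordan (g : ZMod 2 → Submodule K J) (m : J →ₗ[K] J →ₗ[K] J) (α : J →ₗ[K] J) : Prop :=
  EvenBilin g m ∧ EvenMap g α ∧ SuperComm g m ∧ HomJordanId g m α

/-- `α` is multiplicative with respect to `m`. -/
def IsMult (m : J →ₗ[K] J →ₗ[K] J) (α : J →ₗ[K] J) : Prop :=
  ∀ x y : J, α (m x y) = m (α x) (α y)

/-- Multiplicative Hom-Jordan superalgebra. -/
def IsMultHomJordan (g : ZMod 2 → Submodule K J) (m : J →ₗ[K] J →ₗ[K] J) (α : J →ₗ[K] J) :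
    Prop :=
  IsHomJordan g m α ∧ IsMult m α

/-- Evenness of a representation map. -/
def EvenRepMap (g : ZMod 2 → Submodule K J) (gV : ZMod 2 → Submodule K V)
    (π : J →ₗ[K] Module.End K V) : Prop :=
  ∀ i j : ZMod 2, ∀ x ∈ g i, ∀ v ∈ gV j, π x v ∈ gV (i + j)

/-- Representation (module) of a Hom-Jordan superalgebra. -/
def IsRep (g : ZMod 2 → Submodule K J) (m : J →ₗ[K] J →ₗ[K] J) (α : J →ₗ[K] J)
    (gV : ZMod 2 → Submodule K V) (π : J →ₗ[K] Module.End K V) (β : Module.End K V) : Prop :=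
  EvenRepMap g gV π ∧ (∀ i : ZMod 2, ∀ v ∈ gV i, β v ∈ gV i) ∧
  (∀ x : J, β * π x = π (α x) * β) ∧
  (∀ px py pz : ZMod 2, ∀ x ∈ g px, ∀ y ∈ g py, ∀ z ∈ g pz,
      gsign K (px * pz) • (π (m (α x) (α y)) * π (α z) * β)
    + gsign K (px * py) • (π (m (α y) (α z)) * π (α x) * β)
    + gsign K (py * pz) • (π (m (α z) (α x)) * π (α y) * β)
    = gsign K (px * pz) • (π (α (α x)) * π (m y z) * β)
    + gsign K (px * py) • (π (α (α y)) * π (m z x) * β)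
    + gsign K (py * pz) • (π (α (α z)) * π (m x y) * β)) ∧
  (∀ px py pz : ZMod 2, ∀ x ∈ g px, ∀ y ∈ g py, ∀ z ∈ g pz,
      gsign K (px * pz) • (π (m (α x) (α y)) * π (α z) * β)
    + gsign K (px * py) • (π (m (α y) (α z)) * π (α x) * β)
    + gsign K (py * pz) • (π (m (α z) (α x)) * π (α y) * β)
    = gsign K (px * pz) • (π (α (α x)) * π (α y) * π z)
    + gsign K (px * py + py * pz) • (π (α (α z)) * π (α y) * π x)
    + gsign K (py * pz + px * pz) • (π (m (m x z) (α y)) * (β * β)))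

/-- O-operator on `J` associated to the representation `(V, π, β)`. -/
def IsOOperator (g : ZMod 2 → Submodule K J) (m : J →ₗ[K] J →ₗ[K] J) (α : J →ₗ[K] J)
    (gV : ZMod 2 → Submodule K V) (π : J →ₗ[K] Module.End K V) (β : Module.End K V)
    (T : V →ₗ[K] J) : Prop :=
  (∀ i : ZMod 2, ∀ v ∈ gV i, T v ∈ g i) ∧
  (∀ v : V, α (T v) = T (β v)) ∧
  (∀ i j : ZMod 2, ∀ u ∈ gV i, ∀ v ∈ gV j,
    m (T u) (T v) = T (π (T u) v + gsign K (i * j) • π (T v) u))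

/-- The grading on a direct sum `J ⊕ V`. -/
def prodGrading (g : ZMod 2 → Submodule K J) (gV : ZMod 2 → Submodule K V) :
    ZMod 2 → Submodule K (J × V) := fun i => (g i).prod (gV i)

/-- The semidirect product multiplication, determined on homogeneous elements. -/
def IsSemidirectMul (g : ZMod 2 → Submodule K J) (gV : ZMod 2 → Submodule K V)
    (m : J →ₗ[K] J →ₗ[K] J) (π : J →ₗ[K] Module.End K V)
    (m' : (J × V) →ₗ[K] (J × V) →ₗ[K] (J × V)) : Prop :=
  ∀ i j : ZMod 2, ∀ x ∈ g i, ∀ u ∈ gV i, ∀ y ∈ g j, ∀ v ∈ gV j,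
    m' (x, u) (y, v) = (m x y, π x v + gsign K (i * j) • π y u)

/-- The induced grading on the linear dual. -/
def dualGrading (gV : ZMod 2 → Submodule K V) (i : ZMod 2) :
    Submodule K (Module.Dual K V) where
  carrier := {ξ | ∀ x ∈ gV (i + 1), ξ x = 0}
  add_mem' := by
    intro a b ha hb x hx
    simp [ha x hx, hb x hx]
  zero_mem' := by
    intro x hx
    simp
  smul_mem' := by
    intro c a ha x hx
    simp [ha x hx]

/-- Nijenhuis operator on a Hom-Jordan superalgebra. -/
def IsNijenhuis (gA : ZMod 2 → Submodule K J) (mA : J →ₗ[K] J →ₗ[K] J)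
    (γ N : J →ₗ[K] J) : Prop :=
  EvenMap gA N ∧ N ∘ₗ γ = γ ∘ₗ N ∧
  ∀ x y : J, mA (N x) (N y) = N (mA (N x) y + mA x (N y) - N (mA x y))

/-- The super-symmetrized product `x·y = x∘y + (-1)^{|x||y|} y∘x` on homogeneous
elements of parities `i`, `j`. -/
def sMul (c : J →ₗ[K] J →ₗ[K] J) (i j : ZMod 2) (x y : J) : J :=
  c x y + gsign K (i * j) • c y x

/-- Hom-pre-Jordan superalgebra. -/
def IsHomPreJordan (g : ZMod 2 → Submodule K J) (c : J →ₗ[K] J →ₗ[K] J) (α : J →ₗ[K] J) :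
    Prop :=
  EvenBilin g c ∧ EvenMap g α ∧ IsMult c α ∧
  (∀ px py pz pu : ZMod 2, ∀ x ∈ g px, ∀ y ∈ g py, ∀ z ∈ g pz, ∀ u ∈ g pu,
      c (sMul c px py (α x) (α y)) (c (α z) (α u))
    + gsign K (px * (py + pz)) • c (sMul c py pz (α y) (α z)) (c (α x) (α u))
    + gsign K (pz * (px + py)) • c (sMul c pz px (α z) (α x)) (c (α y) (α u))
    = c (α (α x)) (c (sMul c py pz y z) (α u))
    + gsign K (px * (py + pz)) • c (α (α y)) (c (sMul c pz px z x) (α u))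
    + gsign K (pz * (px + py)) • c (α (α z)) (c (sMul c px py x y) (α u))) ∧
  (∀ px py pz pu : ZMod 2, ∀ x ∈ g px, ∀ y ∈ g py, ∀ z ∈ g pz, ∀ u ∈ g pu,
      c (α (α x)) (c (α y) (c z u))
    + gsign K (pz * (px + py) + px * py) • c (α (α z)) (c (α y) (c x u))
    + gsign K (py * pz) • c (sMul c (px + pz) py (sMul c px pz x z) (α y)) (α (α u))
    = c (α (α x)) (c (sMul c py pz y z) (α u))
    + gsign K (px * (py + pz)) • c (α (α y)) (c (sMul c pz px z x) (α u))
    + gsign K (pz * (px + py)) • c (α (α z)) (c (sMul c px py x y) (α u)))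

/-- Hom-dendriform superalgebra, with `p = ≺` and `s = ≻`. -/
def IsHomDendriform (g : ZMod 2 → Submodule K J)
    (p s : J →ₗ[K] J →ₗ[K] J) (α : J →ₗ[K] J) : Prop :=
  EvenBilin g p ∧ EvenBilin g s ∧ EvenMap g α ∧ IsMult p α ∧ IsMult s α ∧
  (∀ x y z : J, s (α x) (s y z) = s (p x y + s x y) (α z)) ∧
  (∀ x y z : J, p (p x y) (α z) = p (α x) (p y z + s y z)) ∧
  (∀ x y z : J, p (s x y) (α z) = s (α x) (p y z))

/-- Hom-alternative superalgebra. -/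
def IsHomAlternative (g : ZMod 2 → Submodule K J) (m : J →ₗ[K] J →ₗ[K] J)
    (α : J →ₗ[K] J) : Prop :=
  EvenBilin g m ∧ EvenMap g α ∧
  (∀ i j : ZMod 2, ∀ x ∈ g i, ∀ y ∈ g j, ∀ z : J,
    hAss m α x y z = -(gsign K (i * j) • hAss m α y x z)) ∧
  (∀ j k : ZMod 2, ∀ y ∈ g j, ∀ z ∈ g k, ∀ x : J,
    hAss m α x y z = -(gsign K (j * k) • hAss m α x z y))

/-- `ass_l` for a Hom-pre-alternative superalgebra, `p = ≺`, `s = ≻`. -/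
def passL (p s : J →ₗ[K] J →ₗ[K] J) (α : J →ₗ[K] J) (x y z : J) : J :=
  s (p x y + s x y) (α z) - s (α x) (s y z)

/-- `ass_m` for a Hom-pre-alternative superalgebra. -/
def passM (p s : J →ₗ[K] J →ₗ[K] J) (α : J →ₗ[K] J) (x y z : J) : J :=
  p (s x y) (α z) - s (α x) (p y z)

/-- `ass_r` for a Hom-pre-alternative superalgebra. -/
def passR (p s : J →ₗ[K] J →ₗ[K] J) (α : J →ₗ[K] J) (x y z : J) : J :=
  p (p x y) (α z) - p (α x) (p y z + s y z)

/-- Hom-pre-alternative superalgebra. -/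
def IsHomPreAlternative (g : ZMod 2 → Submodule K J)
    (p s : J →ₗ[K] J →ₗ[K] J) (α : J →ₗ[K] J) : Prop :=
  EvenBilin g p ∧ EvenBilin g s ∧ EvenMap g α ∧
  (∀ i j : ZMod 2, ∀ x ∈ g i, ∀ y ∈ g j, ∀ z : J,
    passM p s α x y z + gsign K (i * j) • passR p s α y x z = 0) ∧
  (∀ j k : ZMod 2, ∀ y ∈ g j, ∀ z ∈ g k, ∀ x : J,
    passM p s α x y z + gsign K (j * k) • passL p s α x z y = 0) ∧
  (∀ i j : ZMod 2, ∀ x ∈ g i, ∀ y ∈ g j, ∀ z : J,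
    passL p s α x y z + gsign K (i * j) • passL p s α y x z = 0) ∧
  (∀ j k : ZMod 2, ∀ y ∈ g j, ∀ z ∈ g k, ∀ x : J,
    passR p s α x y z + gsign K (j * k) • passR p s α x z y = 0)

/-- `r = Σ Xₗ ⊗ Yₗ` (with `Xₗ, Yₗ` homogeneous of parities `Pₗ, Qₗ`) is
super skew-symmetric: `σ(r) = -r`. -/
def SkewSol {ι : Type*} [Fintype ι] {A : Type*} [AddCommGroup A] [Module K A]
    (X Y : ι → A) (P Q : ι → ZMod 2) : Prop :=
  (∑ l, gsign K (P l * Q l) • (Y l ⊗ₜ[K] X l)) = -(∑ l, X l ⊗ₜ[K] Y l)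

/-- `r = Σ Xₗ ⊗ Yₗ` solves the super Hom-Jordan Yang-Baxter equation
`r₁₂·r₁₃ − r₁₂·r₂₃ + r₁₃·r₂₃ = 0`. -/
def YBESol {ι : Type*} [Fintype ι] {A : Type*} [AddCommGroup A] [Module K A]
    (mA : A →ₗ[K] A →ₗ[K] A) (γ : A →ₗ[K] A) (X Y : ι → A) (P Q : ι → ZMod 2) : Prop :=
  (∑ l, ∑ l', gsign K (P l' * Q l) • ((mA (X l) (X l') ⊗ₜ[K] γ (Y l)) ⊗ₜ[K] γ (Y l')))
    - (∑ l, ∑ l', (γ (X l) ⊗ₜ[K] mA (Y l) (X l')) ⊗ₜ[K] γ (Y l'))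
    + (∑ l, ∑ l', gsign K (P l' * Q l) • ((γ (X l) ⊗ₜ[K] γ (X l')) ⊗ₜ[K] mA (Y l) (Y l')))
    = 0

/-- The left components of the family representing `r = T − σ(T)` in
`(J ⋉ V*) ⊗ (J ⋉ V*)`, for `T` regarded in `J ⊗ V*` via a homogeneous basis. -/
def rX {n : ℕ} (T : V →ₗ[K] J) (b : Module.Basis (Fin n) K V) (pe : Fin n → ZMod 2) :
    Fin n ⊕ Fin n → J × Module.Dual K V :=
  Sum.elim (fun k => (T (b k), 0))
    (fun k => -(gsign K (pe k * pe k)) • ((0 : J), b.coord k))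

/-- The right components of the family representing `r = T − σ(T)`. -/
def rY {n : ℕ} (T : V →ₗ[K] J) (b : Module.Basis (Fin n) K V) :
    Fin n ⊕ Fin n → J × Module.Dual K V :=
  Sum.elim (fun k => ((0 : J), b.coord k)) (fun k => (T (b k), 0))

/-- The parities of the family representing `r = T − σ(T)`. -/
def rP {n : ℕ} (pe : Fin n → ZMod 2) : Fin n ⊕ Fin n → ZMod 2 := Sum.elim pe pe
set_option linter.unusedSectionVars false
set_option linter.unusedSimpArgs false


theorem zmod2_cases (i : ZMod 2) : i = 0 ∨ i = 1 := by
  revert i; decide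

theorem gsign_zero' : gsign K 0 = 1 := by simp [gsign]

theorem gsign_one' : gsign K 1 = -1 := by
  simp [gsign, ZMod.val_one]

theorem zmod2_one_add_one : (1 + 1 : ZMod 2) = 0 := rfl

theorem grading_isCompl (g : ZMod 2 → Submodule K J) (hg : DirectSum.IsInternal g) :
    IsCompl (g 0) (g 1) :=
  hg.isCompl (by decide) (by ext i; simpa using zmod2_cases i)

theorem exists_decomp (g : ZMod 2 → Submodule K J) (hg : DirectSum.IsInternal g) (x : J) :
    ∃ a ∈ g 0, ∃ b ∈ g 1, a + b = x := by
  have h := (grading_isCompl g hg).sup_eq_top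
  have hx : x ∈ g 0 ⊔ g 1 := by rw [h]; trivial
  exact Submodule.mem_sup.mp hx

theorem hom_ext {W : Type*} [AddCommGroup W] [Module K W]
    (g : ZMod 2 → Submodule K J) (hg : DirectSum.IsInternal g) (A B : J →ₗ[K] W)
    (h : ∀ i : ZMod 2, ∀ x ∈ g i, A x = B x) : A = B := by
  ext x
  obtain ⟨a, ha, b, hb, rfl⟩ := exists_decomp g hg x
  rw [map_add, map_add, h 0 a ha, h 1 b hb]

theorem dual_decomp (g : ZMod 2 → Submodule K J) (hg : DirectSum.IsInternal g)
    (f : Module.Dual K J) :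
    ∃ a ∈ dualGrading g 0, ∃ b ∈ dualGrading g 1, a + b = f := by
  have hc := grading_isCompl g hg
  refine ⟨f ∘ₗ (Submodule.projection _ _ hc), ?_, f ∘ₗ (Submodule.projection _ _ hc.symm), ?_, ?_⟩
  · intro x hx
    rw [zero_add] at hx
    have : (Submodule.projection _ _ hc) x = 0 := by simpa using hx
    simp [this]
  · intro x hx
    rw [zmod2_one_add_one] at hx
    have : (Submodule.projection _ _ hc.symm) x = 0 := by simpa using hx
    simp [this]
  · refine hom_ext g hg _ _ ?_
    intro i x hx
    rcases zmod2_cases i with rfl | rfl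
    · have h1 : (Submodule.projection _ _ hc.symm) x = 0 := by simpa using hx
      have h2 : (Submodule.projection _ _ hc) x = x := by simpa using hx
      simp [h1, h2]
    · have h1 : (Submodule.projection _ _ hc) x = 0 := by simpa using hx
      have h2 : (Submodule.projection _ _ hc.symm) x = x := by simpa using hx
      simp [h1, h2]

theorem end_ext (g : ZMod 2 → Submodule K J) (hg : DirectSum.IsInternal g)
    (A B : Module.End K (Module.Dual K J))
    (h : ∀ j : ZMod 2, ∀ f ∈ dualGrading g j, ∀ i : ZMod 2, ∀ w ∈ g i, A f w = B f w) :
    A = B := by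
  apply LinearMap.ext
  intro f
  obtain ⟨a, ha, b, hb, rfl⟩ := dual_decomp g hg f
  rw [map_add, map_add, hom_ext g hg (A a) (B a) (h 0 a ha),
    hom_ext g hg (A b) (B b) (h 1 b hb)]

theorem symm_even (g : ZMod 2 → Submodule K J) (hg : DirectSum.IsInternal g)
    (α : J ≃ₗ[K] J) (hα : EvenMap g α.toLinearMap) (i : ZMod 2) (x : J) (hx : x ∈ g i) :
    α.symm x ∈ g i := by
  have hc := grading_isCompl g hg
  obtain ⟨a, ha, b, hb, hab⟩ := exists_decomp g hg (α.symm x)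
  have hx' : x = α a + α b := by
    rw [← map_add, hab, LinearEquiv.apply_symm_apply]
  have ha' : α a ∈ g 0 := hα 0 a ha
  have hb' : α b ∈ g 1 := hα 1 b hb
  rcases zmod2_cases i with rfl | rfl
  · have h0 : α b ∈ g 0 := by
      have : α b = x - α a := by rw [hx']; abel
      rw [this]; exact sub_mem hx ha'
    have : α b = 0 := (Submodule.disjoint_def.mp hc.disjoint) _ h0 hb'
    have : b = 0 := by simpa using this
    rw [← hab, this, add_zero]; exact ha
  · have h0 : α a ∈ g 1 := by
      have : α a = x - α b := by rw [hx']; abel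
      rw [this]; exact sub_mem hx hb'
    have : α a = 0 := (Submodule.disjoint_def.mp hc.disjoint) _ ha' h0
    have : a = 0 := by simpa using this
    rw [← hab, this, zero_add]; exact hb

/-- The untwisted Jordan superidentity. -/
def JId (g : ZMod 2 → Submodule K J) (p : J →ₗ[K] J →ₗ[K] J) : Prop :=
  ∀ px py pz pu : ZMod 2, ∀ x ∈ g px, ∀ y ∈ g py, ∀ z ∈ g pz, ∀ u ∈ g pu,
      gsign K (pu * (px + pz)) • (p (p (p x y) z) u - p (p x y) (p z u))
    + gsign K (px * (py + pz)) • (p (p (p y u) z) x - p (p y u) (p z x))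
    + gsign K (py * (pu + pz)) • (p (p (p u x) z) y - p (p u x) (p z y)) = 0

theorem jid_untwist (g : ZMod 2 → Submodule K J) 
    (m p : J →ₗ[K] J →ₗ[K] J) (α : J ≃ₗ[K] J) (hid : HomJordanId g m α.toLinearMap)
    (hp : ∀ x y, m x y = α (p x y)) (hm : ∀ x y, α (p x y) = p (α x) (α y)) : JId g p := by
  intro px py pz pu x hx y hy z hz u hu
  have h := hid px py pz pu x hx y hy z hz u hu
  have key : ∀ x y z u : J, hAss m α.toLinearMap (m x y) (α.toLinearMap z) (α.toLinearMap u)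
      = α (α (α (p (p (p x y) z) u - p (p x y) (p z u)))) := by
    intro x y z u
    simp only [hAss, hp, hm, map_sub, LinearEquiv.coe_coe]
  rw [key, key, key] at h
  simp only [← map_smul, ← map_add] at h
  simpa only [LinearEquiv.map_eq_zero_iff] using h

theorem lemA (g : ZMod 2 → Submodule K J) (p : J →ₗ[K] J →ₗ[K] J)
    (he : EvenBilin g p) (hc : SuperComm g p) (hj : JId g p)
    (px py pz pw : ZMod 2) (x y z w : J) (hx : x ∈ g px) (hy : y ∈ g py) (hz : z ∈ g pz)
    (hw : w ∈ g pw) :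
      gsign K (px * pz + (px + py) * pz) • p z (p (p x y) w)
    + gsign K (px * py + (py + pz) * px) • p x (p (p y z) w)
    + gsign K (py * pz + (pz + px) * py) • p y (p (p z x) w)
    = gsign K (px * pz + (py + pz) * px) • p (p y z) (p x w)
    + gsign K (px * py + (pz + px) * py) • p (p z x) (p y w)
    + gsign K (py * pz + (px + py) * pz) • p (p x y) (p z w) := by
  have h := hj px py pw pz x hx y hy w hw z hz
  rw [hc (px + py + pw) pz _ (he _ _ _ (he _ _ _ hx _ hy) _ hw) _ hz,
    hc (py + pz + pw) px _ (he _ _ _ (he _ _ _ hy _ hz) _ hw) _ hx,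
    hc (pz + px + pw) py _ (he _ _ _ (he _ _ _ hz _ hx) _ hw) _ hy,
    hc pw pz _ hw _ hz, hc pw px _ hw _ hx, hc pw py _ hw _ hy] at h
  rcases zmod2_cases px with rfl | rfl <;> rcases zmod2_cases py with rfl | rfl <;>
  rcases zmod2_cases pz with rfl | rfl <;> rcases zmod2_cases pw with rfl | rfl <;>
  simp only [add_zero, zero_add, mul_zero, zero_mul, mul_one, one_mul, zmod2_one_add_one,
    gsign_zero', gsign_one', one_smul, neg_smul, map_neg, map_smul] at h ⊢ <;>
  first
  | linear_combination (norm := module) h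
  | linear_combination (norm := module) -h

theorem lemB (g : ZMod 2 → Submodule K J) (p : J →ₗ[K] J →ₗ[K] J)
    (he : EvenBilin g p) (hc : SuperComm g p) (hj : JId g p)
    (px py pz pw : ZMod 2) (x y z w : J) (hx : x ∈ g px) (hy : y ∈ g py) (hz : z ∈ g pz)
    (hw : w ∈ g pw) :
      gsign K (px * pz + (py + pz) * px) • p (p y z) (p x w)
    + gsign K (px * py + (pz + px) * py) • p (p z x) (p y w)
    + gsign K (py * pz + (px + py) * pz) • p (p x y) (p z w)
    = gsign K (px * pz + px * py + px * pz + py * pz) • p z (p y (p x w))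
    + gsign K (px * py + py * pz + px * py + px * pz + py * pz) • p x (p y (p z w))
    + gsign K (py * pz + px * pz) • p (p (p x z) y) w := by
  have h := hj pw pz py px w hw z hz y hy x hx
  rw [hc (pw + pz + py) px _ (he _ _ _ (he _ _ _ hw _ hz) _ hy) _ hx,
    hc (pw + pz) py _ (he _ _ _ hw _ hz) _ hy,
    hc pw pz _ hw _ hz,
    hc (px + pw + py) pz _ (he _ _ _ (he _ _ _ hx _ hw) _ hy) _ hz,
    hc (px + pw) py _ (he _ _ _ hx _ hw) _ hy,
    hc pz px _ hz _ hx] at h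
  simp only [map_smul, LinearMap.smul_apply] at h
  rw [hc (pz + pw) (py + px) _ (he _ _ _ hz _ hw) _ (he _ _ _ hy _ hx),
    hc (px + pw) (py + pz) _ (he _ _ _ hx _ hw) _ (he _ _ _ hy _ hz), 
    hc py px _ hy _ hx] at h
  simp only [map_smul, LinearMap.smul_apply] at h
  rw [hc pz px _ hz _ hx]
  simp only [map_smul, LinearMap.smul_apply]
  rcases zmod2_cases px with rfl | rfl <;> rcases zmod2_cases py with rfl | rfl <;>
  rcases zmod2_cases pz with rfl | rfl <;> rcases zmod2_cases pw with rfl | rfl <;>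
  simp only [add_zero, zero_add, mul_zero, zero_mul, mul_one, one_mul, zmod2_one_add_one,
    gsign_zero', gsign_one', one_smul, neg_smul, map_neg, map_smul] at h ⊢ <;>
  first
  | linear_combination (norm := module) h
  | linear_combination (norm := module) -h

/-- the coadjoint representation `(J*, ad⋆, (α⁻¹)*)` of a
finite-dimensional multiplicative Hom-Jordan superalgebra with `α` invertible,
where `ad⋆(x)(f) = ad*(α(x))((α⁻²)*(f))`. -/
theorem coadjoint_representation [FiniteDimensional K J]
    (g : ZMod 2 → Submodule K J) (hg : DirectSum.IsInternal g)
    (m : J →ₗ[K] J →ₗ[K] J) (α : J ≃ₗ[K] J)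
    (hJ : IsMultHomJordan g m α.toLinearMap)
    (adStar : J →ₗ[K] Module.End K (Module.Dual K J))
    (hadStar : ∀ i j : ZMod 2, ∀ x ∈ g i, ∀ f ∈ dualGrading g j, ∀ y : J,
      adStar x f y = gsign K (i * j) * f (α.symm (α.symm (m (α x) y)))) :
    IsRep g m α.toLinearMap (dualGrading g) adStar (α.symm.toLinearMap.dualMap) := by
  obtain ⟨⟨hev, hα, hcomm, hid⟩, hmult⟩ := hJ
  have hmu : ∀ x y, α (m x y) = m (α x) (α y) := fun x y => hmult x y
  set p : J →ₗ[K] J →ₗ[K] J := m.compr₂ α.symm.toLinearMap with hpdef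
  have hpa : ∀ x y, p x y = α.symm (m x y) := fun x y => rfl
  have hp : ∀ x y, m x y = α (p x y) := fun x y => by simp [hpa]
  have hm : ∀ x y, α (p x y) = p (α x) (α y) := fun x y => by
    simp [hpa, ← hmu]
  have hms : ∀ x y, α.symm (p x y) = p (α.symm x) (α.symm y) := fun x y => by
    rw [LinearEquiv.symm_apply_eq, hm]; simp
  have hs := symm_even g hg α hα
  have hα' : ∀ i : ZMod 2, ∀ x ∈ g i, α x ∈ g i := hα
  have he : EvenBilin g p := fun i j x hx y hy => hs _ _ (hev i j x hx y hy)
  have hc : SuperComm g p := fun i j x hx y hy => by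
    rw [hpa, hpa, hcomm i j x hx y hy, map_smul]
  have hj : JId g p := jid_untwist g m p α hid hp hm
  have had : ∀ i j : ZMod 2, ∀ x ∈ g i, ∀ f ∈ dualGrading g j, ∀ y : J,
      adStar x f y = gsign K (i * j) * f (p x (α.symm y)) := by
    intro i j x hx f hf y
    rw [hadStar i j x hx f hf y, ← hpa, hms, LinearEquiv.symm_apply_apply]
  have hE : EvenRepMap g (dualGrading g) adStar := by
    intro i j x hx f hf w hw
    rw [had i j x hx f hf w, hf _ _, mul_zero]
    have := he _ _ x hx _ (hs _ _ hw)
    have e : i + (i + j + 1) = j + 1 := by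
      clear this hw hf hx; revert i j; decide
    rwa [e] at this
  have hB : ∀ i : ZMod 2, ∀ v ∈ dualGrading g i, α.symm.toLinearMap.dualMap v ∈ dualGrading g i := by
    intro i f hf w hw
    exact hf _ (hs _ _ hw)
  have hBa : ∀ (f : Module.Dual K J) (w : J), α.symm.toLinearMap.dualMap f w = f (α.symm w) :=
    fun f w => rfl
  generalize α.symm.toLinearMap.dualMap = β at hB hBa ⊢
  -- the general shapes
  have h2 : ∀ pa pb pf : ZMod 2, ∀ a ∈ g pa, ∀ b ∈ g pb, ∀ f ∈ dualGrading g pf, ∀ w : J,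
      (adStar (α (α a)) * adStar (α b) * β) f w
        = gsign K (pa * (pb + pf)) * (gsign K (pb * pf) *
          f (p b (p a (α.symm (α.symm (α.symm w)))))) := by
    intro pa pb pf a ha b hb f hf w
    simp only [Module.End.mul_apply]
    rw [had pa (pb + pf) _ (hα' _ _ (hα' _ _ ha)) _ (hE _ _ _ (hα' _ _ hb) _ (hB _ _ hf)),
      had pb pf _ (hα' _ _ hb) _ (hB _ _ hf), hBa]
    simp only [hms, LinearEquiv.symm_apply_apply]
  have h3 : ∀ pa pb pc pf : ZMod 2, ∀ a ∈ g pa, ∀ b ∈ g pb, ∀ c ∈ g pc,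
      ∀ f ∈ dualGrading g pf, ∀ w : J,
      (adStar (α (α a)) * adStar (α b) * adStar c) f w
        = gsign K (pa * (pb + (pc + pf))) * (gsign K (pb * (pc + pf)) * (gsign K (pc * pf) *
          f (p c (p b (p a (α.symm (α.symm (α.symm w)))))))) := by
    intro pa pb pc pf a ha b hb c hc f hf w
    simp only [Module.End.mul_apply]
    rw [had pa (pb + (pc + pf)) _ (hα' _ _ (hα' _ _ ha)) _
        (hE _ _ _ (hα' _ _ hb) _ (hE _ _ _ hc _ hf)),
      had pb (pc + pf) _ (hα' _ _ hb) _ (hE _ _ _ hc _ hf), had pc pf _ hc _ hf]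
    simp only [hms, LinearEquiv.symm_apply_apply]
  have h1 : ∀ pa pf : ZMod 2, ∀ a ∈ g pa, ∀ f ∈ dualGrading g pf, ∀ w : J,
      (adStar (α (α a)) * (β * β)) f w
        = gsign K (pa * pf) * f (p a (α.symm (α.symm (α.symm w)))) := by
    intro pa pf a ha f hf w
    simp only [Module.End.mul_apply]
    rw [had pa pf _ (hα' _ _ (hα' _ _ ha)) _ (hB _ _ (hB _ _ hf)), hBa, hBa]
    simp only [hms, LinearEquiv.symm_apply_apply]
  have e1 : ∀ a b, m (α a) (α b) = α (α (p a b)) := fun a b => by rw [hp, ← hm]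
  have e2 : ∀ a b c, m (m a c) (α b) = α (α (p (p a c) b)) := fun a b c => by
    rw [hp (m a c), hp a c, ← hm (p a c)]
  have hlc : ∀ x, α.toLinearMap x = α x := fun x => rfl
  refine ⟨hE, hB, ?_, ?_, ?_⟩
  · intro x
    have key : ∀ i : ZMod 2, ∀ x ∈ g i, β * adStar x = adStar (α x) * β := by
      intro i x hx
      refine end_ext g hg _ _ ?_
      intro j f hf k w hw
      simp only [Module.End.mul_apply]
      rw [hBa, had i j _ hx _ hf, had i j _ (hα' _ _ hx) _ (hB _ _ hf), hBa]
      simp only [hms, LinearEquiv.symm_apply_apply]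
    obtain ⟨a, ha, b, hb, rfl⟩ := exists_decomp g hg x
    simp only [hlc, map_add, mul_add, add_mul, key 0 a ha, key 1 b hb]
  · intro px py pz x hx y hy z hz
    refine end_ext g hg _ _ ?_
    intro pf f hf pw w hw
    simp only [hlc, e1, LinearMap.add_apply, LinearMap.smul_apply, smul_eq_mul]
    rw [hp y z, hp z x, hp x y,
      h2 _ _ pf _ (he _ _ _ hx _ hy) _ hz _ hf, h2 _ _ pf _ (he _ _ _ hy _ hz) _ hx _ hf,
      h2 _ _ pf _ (he _ _ _ hz _ hx) _ hy _ hf, h2 _ _ pf _ hx _ (he _ _ _ hy _ hz) _ hf,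
      h2 _ _ pf _ hy _ (he _ _ _ hz _ hx) _ hf, h2 _ _ pf _ hz _ (he _ _ _ hx _ hy) _ hf]
    have hA := congrArg f (lemA g p he hc hj px py pz pw x y z _ hx hy hz
      (hs _ _ (hs _ _ (hs _ _ hw))))
    simp only [map_add, map_smul, smul_eq_mul] at hA
    rcases zmod2_cases px with rfl | rfl <;> rcases zmod2_cases py with rfl | rfl <;>
    rcases zmod2_cases pz with rfl | rfl <;> rcases zmod2_cases pf with rfl | rfl <;>
    simp only [add_zero, zero_add, mul_zero, zero_mul, mul_one, one_mul, zmod2_one_add_one,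
      gsign_zero', gsign_one'] at hA ⊢ <;>
    first
    | linear_combination hA
    | linear_combination -hA
  · intro px py pz x hx y hy z hz
    refine end_ext g hg _ _ ?_
    intro pf f hf pw w hw
    simp only [hlc, e1, e2, LinearMap.add_apply, LinearMap.smul_apply, smul_eq_mul]
    rw [h2 _ _ pf _ (he _ _ _ hx _ hy) _ hz _ hf, h2 _ _ pf _ (he _ _ _ hy _ hz) _ hx _ hf,
      h2 _ _ pf _ (he _ _ _ hz _ hx) _ hy _ hf,
      h3 _ _ _ pf _ hx _ hy _ hz _ hf, h3 _ _ _ pf _ hz _ hy _ hx _ hf,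
      h1 _ pf _ (he _ _ _ (he _ _ _ hx _ hz) _ hy) _ hf]
    have hA := congrArg f ((lemA g p he hc hj px py pz pw x y z _ hx hy hz
      (hs _ _ (hs _ _ (hs _ _ hw)))).trans (lemB g p he hc hj px py pz pw x y z _ hx hy hz
      (hs _ _ (hs _ _ (hs _ _ hw)))))
    simp only [map_add, map_smul, smul_eq_mul] at hA
    rcases zmod2_cases px with rfl | rfl <;> rcases zmod2_cases py with rfl | rfl <;>
    rcases zmod2_cases pz with rfl | rfl <;> rcases zmod2_cases pf with rfl | rfl <;>
    simp only [add_zero, zero_add, mul_zero, zero_mul, mul_one, one_mul, zmod2_one_add_one,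
      gsign_zero', gsign_one'] at hA ⊢ <;>
    first
    | linear_combination hA
    | linear_combination -hA
end
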